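/- arXiv:2604.19358 — 2 statements merged into one kernel-verified Lean document; each statement's English description precedes it below -/
import Mathlib

section
/- (Logarithmic kernel bound on the strip Q₃.) There exists an absolute constant C > 0 such that for every (φ,θ) ∈ (0,1]², writing x = x(φ,θ) and Q₃ := { x(φ',θ') : φ' ∈ [3φ/2, π), θ' ∈ (0, 3θ/2] } ⊂ S², one has ∫_{Q₃} ( 2 y₂ |x₃ − y₃| ) / ( |x−y|² |x−ỹ|² ) dσ(y) ≤ C · ( ln(1 + θ/φ) + 1 ). -/
open MeasureTheory Real Filter Set
open scoped ENNReal NNReal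

noncomputable section

abbrev E3 : Type := EuclideanSpace ℝ (Fin 3)

/-- The vector `(a, b, c)` in `ℝ³`. -/
def vec3 (a b c : ℝ) : E3 := (WithLp.equiv 2 (Fin 3 → ℝ)).symm ![a, b, c]

/-- Euclidean dot product in `ℝ³`. -/
def dot3 (x y : E3) : ℝ := x 0 * y 0 + x 1 * y 1 + x 2 * y 2

/-- Cross product in `ℝ³`. -/
def cross3 (x y : E3) : E3 :=
  vec3 (x 1 * y 2 - x 2 * y 1) (x 2 * y 0 - x 0 * y 2) (x 0 * y 1 - x 1 * y 0)

/-- The unit sphere `S²` in `ℝ³`. -/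
def S2 : Set E3 := Metric.sphere (0 : E3) 1

/-- The surface measure on `S²`: the 2-dimensional Hausdorff measure restricted to `S²`. -/
def sigma2 : Measure E3 := (μH[2] : Measure E3).restrict S2

/-- Spherical coordinates. -/
def sc (φ θ : ℝ) : E3 := vec3 (cos θ * cos φ) (cos θ * sin φ) (sin θ)

/-- The Biot–Savart velocity of a vorticity `ω` on the sphere. -/
def biotSavart (ω : E3 → ℝ) (x : E3) : E3 :=
  (2 * Real.pi)⁻¹ • ∫ y, (‖x - y‖ ^ 2)⁻¹ • ω y • cross3 x y ∂sigma2

/-- The unit tangent vector `e_φ`. -/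
def ephi (y : E3) : E3 := vec3 (-(y 1) / sqrt (1 - (y 2) ^ 2)) (y 0 / sqrt (1 - (y 2) ^ 2)) 0

/-- The unit tangent vector `e_θ`. -/
def etheta (y : E3) : E3 :=
  vec3 (-(y 2) * y 0 / sqrt (1 - (y 2) ^ 2)) (-(y 2) * y 1 / sqrt (1 - (y 2) ^ 2))
    (sqrt (1 - (y 2) ^ 2))

/-- Reflection in the second coordinate: `ỹ`. -/
def flip2 (y : E3) : E3 := vec3 (y 0) (-(y 1)) (y 2)

/-- Reflection in the third coordinate: `ȳ`. -/
def flip3 (y : E3) : E3 := vec3 (y 0) (y 1) (-(y 2))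

/-- `ω` is odd-odd symmetric on the sphere. -/
def OddOdd (ω : E3 → ℝ) : Prop := ∀ x ∈ S2, ω (flip2 x) = -ω x ∧ ω (flip3 x) = -ω x

def x₀ : E3 := vec3 1 0 0

/-- The region `Q(k₁, k₂)` on the sphere. -/
def Qset (k₁ k₂ : ℝ) : Set E3 :=
  (fun p : ℝ × ℝ => sc p.1 p.2) '' (Ioo k₁ Real.pi ×ˢ Ioo k₂ (Real.pi / 2))

/-- The open quarter sphere. -/
def S2q : Set E3 := {y ∈ S2 | 0 < y 1 ∧ 0 < y 2}

/-- The (possibly infinite) Lipschitz constant of `f` on the set `s`. -/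
def lipOn (f : ℝ × ℝ → ℝ) (s : Set (ℝ × ℝ)) : ℝ≥0∞ :=
  ⨆ p ∈ s, ⨆ q ∈ s, edist (f p) (f q) / edist p q

lemma lint_ftc (f F : ℝ → ℝ) (p q : ℝ) (hpq : p ≤ q) (hc : ContinuousOn f (Icc p q))
    (h0 : ∀ x ∈ Icc p q, 0 ≤ f x) (hF : ∀ x ∈ Icc p q, HasDerivAt F (f x) x) :
    ∫⁻ x in Icc p q, ENNReal.ofReal (f x) = ENNReal.ofReal (F q - F p) := by
  rw [← ofReal_integral_eq_lintegral_ofReal (hc.integrableOn_compact isCompact_Icc)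
    ((ae_restrict_iff' measurableSet_Icc).2 (Eventually.of_forall h0))]
  congr 1
  rw [integral_Icc_eq_integral_Ioc, ← intervalIntegral.integral_of_le hpq]
  apply intervalIntegral.integral_eq_sub_of_hasDerivAt
  · rwa [uIcc_of_le hpq]
  · apply ContinuousOn.intervalIntegrable
    rwa [uIcc_of_le hpq]

lemma inner_bd (a θ : ℝ) (ha : 0 < a) (hθ : 0 < θ) :
    ∫⁻ t in Ioc 0 (3 * θ / 2), ENNReal.ofReal (a * |θ - t| / ((θ - t) ^ 2 + a ^ 2) ^ 2)
      ≤ ENNReal.ofReal (θ ^ 2 / (a * (a ^ 2 + θ ^ 2))) := by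
  have hsub : Ioc 0 (3 * θ / 2) ⊆ Icc 0 θ ∪ Icc θ (2 * θ) := by
    intro t ht
    rcases le_total t θ with h | h
    · exact Or.inl ⟨ht.1.le, h⟩
    · exact Or.inr ⟨h, by linarith [ht.2]⟩
  refine (lintegral_mono_set hsub).trans ((lintegral_union_le _ _ _).trans ?_)
  have hd : ∀ t : ℝ, (θ - t) ^ 2 + a ^ 2 ≠ 0 := fun t => by positivity
  have hD : ∀ t : ℝ, HasDerivAt (fun t => 1 / (2 * a) * ((θ - t) ^ 2 / ((θ - t) ^ 2 + a ^ 2)))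
      (-(a * (θ - t) / ((θ - t) ^ 2 + a ^ 2) ^ 2)) t := by
    intro t
    have h1 : HasDerivAt (fun t => (θ - t) ^ 2) (2 * (θ - t) * (-1)) t := by
      have h0 := ((hasDerivAt_id t).const_sub θ).pow 2
      refine h0.congr_deriv ?_
      simp
    have h2 := ((h1.div (h1.add_const (a ^ 2)) (hd t))).const_mul (1 / (2 * a))
    refine h2.congr_deriv ?_
    have := hd t
    field_simp
    ring
  have hcont : Continuous (fun t : ℝ => a * |θ - t| / ((θ - t) ^ 2 + a ^ 2) ^ 2) := by
    refine Continuous.div (by fun_prop) (by fun_prop) (fun t => pow_ne_zero _ (hd t))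
  rw [lint_ftc _ (fun t => -(1 / (2 * a) * ((θ - t) ^ 2 / ((θ - t) ^ 2 + a ^ 2)))) 0 θ hθ.le
      hcont.continuousOn (fun t _ => by positivity),
    lint_ftc _ (fun t => (1 / (2 * a) * ((θ - t) ^ 2 / ((θ - t) ^ 2 + a ^ 2)))) θ (2 * θ)
      (by linarith) hcont.continuousOn (fun t _ => by positivity), ← ENNReal.ofReal_add]
  · apply ENNReal.ofReal_le_ofReal
    apply le_of_eq
    have : a ^ 2 + θ ^ 2 ≠ 0 := by positivity
    have : θ ^ 2 + a ^ 2 ≠ 0 := by positivity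
    have e : (θ - 2 * θ) ^ 2 = θ ^ 2 := by ring
    simp only [sub_self, sub_zero, e]
    field_simp
    ring
  · simp; positivity
  · simp; positivity
  · intro t ht
    refine (hD t).congr_deriv ?_
    rw [abs_of_nonpos (by linarith [ht.1])]; ring
  · intro t ht
    refine (hD t).neg.congr_deriv ?_
    rw [abs_of_nonneg (by linarith [ht.2])]; ring

lemma outer_bd (φ θ : ℝ) (hφ : 0 < φ) (hφ1 : φ ≤ 1) (hθ : 0 < θ) :
    ∫⁻ a in Ico (3 * φ / 2) π, ENNReal.ofReal (θ ^ 2 / (a * (a ^ 2 + θ ^ 2)))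
      ≤ ENNReal.ofReal (log (1 + θ / φ)) := by
  have hpi := Real.pi_gt_three
  refine (lintegral_mono_set Ico_subset_Icc_self).trans ?_
  rw [lint_ftc _ (fun a => log a - 1 / 2 * log (a ^ 2 + θ ^ 2)) _ _ (by linarith)]
  · apply ENNReal.ofReal_le_ofReal
    have h1 : log π ≤ 1 / 2 * log (π ^ 2 + θ ^ 2) := by
      have : log (π ^ 2) ≤ log (π ^ 2 + θ ^ 2) := log_le_log (by positivity) (by nlinarith)
      rw [Real.log_pow] at this
      push_cast at this
      linarith
    have hp : 0 < 3 * φ / 2 := by positivity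
    have h2 : 1 / 2 * log ((3 * φ / 2) ^ 2 + θ ^ 2) ≤ log (3 * φ / 2) + log (1 + θ / φ) := by
      rw [← log_mul hp.ne' (by positivity)]
      have : log ((3 * φ / 2) ^ 2 + θ ^ 2) ≤ log ((3 * φ / 2 * (1 + θ / φ)) ^ 2) := by
        apply log_le_log (by positivity)
        have : 3 * φ / 2 * (1 + θ / φ) = 3 * φ / 2 + 3 / 2 * θ := by field_simp
        rw [this]
        nlinarith [mul_pos hφ hθ, sq_nonneg θ]
      rw [Real.log_pow] at this
      push_cast at this
      linarith
    linarith
  · apply ContinuousOn.div (by fun_prop) (by fun_prop)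
    intro a ha
    have : 0 < a := by linarith [ha.1]
    positivity
  · intro a ha
    have : 0 < a := by linarith [ha.1]
    positivity
  · intro a ha
    have ha0 : 0 < a := by linarith [ha.1]
    have hh : a ^ 2 + θ ^ 2 ≠ 0 := by positivity
    have h1 : HasDerivAt (fun t : ℝ => t ^ 2 + θ ^ 2) (2 * a) a := by
      simpa using (hasDerivAt_pow 2 a).add_const (θ ^ 2)
    have := (Real.hasDerivAt_log ha0.ne').sub ((h1.log hh).const_mul (1 / 2))
    refine this.congr_deriv ?_
    field_simp
    ring

lemma double_bd (φ θ : ℝ) (hφ : 0 < φ) (hφ1 : φ ≤ 1) (hθ : 0 < θ) :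
    ∫⁻ p in Ico (3 * φ / 2) π ×ˢ Ioc (0:ℝ) (3 * θ / 2),
        ENNReal.ofReal (p.1 * |θ - p.2| / ((θ - p.2) ^ 2 + p.1 ^ 2) ^ 2)
      ≤ ENNReal.ofReal (log (1 + θ / φ)) := by
  rw [Measure.volume_eq_prod, ← Measure.prod_restrict, lintegral_prod _ (by fun_prop)]
  refine le_trans ?_ (outer_bd φ θ hφ hφ1 hθ)
  apply setLIntegral_mono' measurableSet_Ico
  intro a ha
  exact inner_bd a θ (by linarith [ha.1]) hθ

lemma normsq (φ θ a t : ℝ) : ‖sc φ θ - sc a t‖ ^ 2 =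
    4 * sin ((θ - t) / 2) ^ 2 + 4 * (cos θ * cos t) * sin ((a - φ) / 2) ^ 2 := by
  have h1 : sin ((θ - t) / 2) ^ 2 = (1 - cos (θ - t)) / 2 := by
    rw [sin_sq_eq_half_sub]; ring_nf
  have h2 : sin ((a - φ) / 2) ^ 2 = (1 - cos (a - φ)) / 2 := by
    rw [sin_sq_eq_half_sub]; ring_nf
  rw [h1, h2, cos_sub, cos_sub, EuclideanSpace.norm_sq_eq, Fin.sum_univ_three]
  simp [sc, vec3]
  have e1 := sin_sq_add_cos_sq θ
  have e2 := sin_sq_add_cos_sq t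
  have e3 := sin_sq_add_cos_sq φ
  have e4 := sin_sq_add_cos_sq a
  linear_combination e1 + e2 + cos θ ^ 2 * e3 + cos t ^ 2 * e4

lemma flip2_sc (a t : ℝ) : flip2 (sc a t) = sc (-a) t := by
  simp [flip2, sc, vec3]

lemma sc_lip : LipschitzWith 2 (fun p : ℝ × ℝ => sc p.1 p.2) := by
  apply LipschitzWith.of_dist_le_mul
  rintro ⟨a, b⟩ ⟨c, d⟩
  have h1 : |a - c| ≤ dist (a, b) (c, d) := by
    rw [Prod.dist_eq, Real.dist_eq]; exact le_max_left _ _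
  have h2 : |b - d| ≤ dist (a, b) (c, d) := by
    rw [Prod.dist_eq, Real.dist_eq, Real.dist_eq]; exact le_max_right _ _
  generalize dist (a, b) (c, d) = D at *
  have hD : 0 ≤ D := (abs_nonneg _).trans h1
  rw [dist_eq_norm]
  apply le_of_sq_le_sq _ (by positivity)
  simp only []
  rw [normsq]
  have k1 : sin ((b - d) / 2) ^ 2 ≤ (D / 2) ^ 2 := by
    apply sq_le_sq'  <;> have := abs_le.1 (abs_sin_le_abs (x := (b - d) / 2)) <;>
      rw [abs_div, abs_two] at this <;> linarith [this.1, this.2]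
  have k2 : sin ((c - a) / 2) ^ 2 ≤ (D / 2) ^ 2 := by
    apply sq_le_sq'  <;> have := abs_le.1 (abs_sin_le_abs (x := (c - a) / 2)) <;>
      rw [abs_div, abs_two, abs_sub_comm] at this <;> linarith [this.1, this.2]
  have k3 : cos b * cos d ≤ 1 := by
    nlinarith [sin_sq_add_cos_sq b, sin_sq_add_cos_sq d, sq_nonneg (cos b - cos d), sq_nonneg (sin b), sq_nonneg (sin d)]
  have k4 : cos b * cos d * sin ((c - a) / 2) ^ 2 ≤ 1 * sin ((c - a) / 2) ^ 2 :=
    mul_le_mul_of_nonneg_right k3 (sq_nonneg _)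
  push_cast
  nlinarith [sq_nonneg D]

lemma pointwise (φ θ a t : ℝ) (hφ : 0 < φ) (hφ1 : φ ≤ 1) (hθ : 0 < θ) (hθ1 : θ ≤ 1)
    (ha : 3 * φ / 2 ≤ a) (haπ : a < π) (ht : 0 < t) (ht1 : t ≤ 3 * θ / 2) :
    ‖2 * (sc a t) 1 * |(sc φ θ) 2 - (sc a t) 2| /
      (‖sc φ θ - sc a t‖ ^ 2 * ‖sc φ θ - flip2 (sc a t)‖ ^ 2)‖ ≤
    8000000 * (a * |θ - t| / ((θ - t) ^ 2 + a ^ 2) ^ 2) := by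
  have hpi := Real.pi_gt_d2
  have hpi2 := Real.pi_lt_d2
  have ha0 : 0 < a := by linarith
  have hip : 0.63 < 2 / π := by rw [lt_div_iff₀ (by linarith)]; linarith
  have hip2 : 2 / π < 0.64 := by rw [div_lt_iff₀ (by linarith)]; linarith
  have hsin : ∀ u, 0 ≤ u → u ≤ π / 2 → 0.63 * u ≤ sin u := fun u h0 h1 =>
    (mul_le_mul_of_nonneg_right hip.le h0).trans (mul_le_sin h0 h1)
  have c1 : 1 / 2 ≤ cos θ := by
    have := one_sub_sq_div_two_le_cos (x := θ)
    nlinarith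
  have c2 : 1 / 25 ≤ cos t := by
    have := one_sub_mul_le_cos ht.le (by linarith)
    nlinarith
  have c3 : 1 / 50 ≤ cos θ * cos t := by nlinarith
  have s0 : (θ - t) ^ 2 / 1600 ≤ sin ((θ - t) / 2) ^ 2 := by
    rcases le_total t θ with h | h
    · have := hsin ((θ - t) / 2) (by linarith) (by linarith)
      nlinarith
    · have := hsin (-((θ - t) / 2)) (by linarith) (by linarith)
      rw [sin_neg] at this
      nlinarith
  have s1 : a / 10 ≤ sin ((a - φ) / 2) := by
    have := hsin ((a - φ) / 2) (by linarith) (by linarith)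
    linarith
  have s2 : a / 10 ≤ sin ((a + φ) / 2) := by
    rcases le_total ((a + φ) / 2) (π / 2) with h | h
    · have := hsin ((a + φ) / 2) (by linarith) h
      linarith
    · have := hsin (π - (a + φ) / 2) (by linarith) (by linarith)
      rw [sin_pi_sub] at this
      linarith
  have key : ∀ w, a / 10 ≤ w → ((θ - t) ^ 2 + a ^ 2) / 2000 ≤
      4 * sin ((θ - t) / 2) ^ 2 + 4 * (cos θ * cos t) * w ^ 2 := by
    intro w hw
    have h1 : a ^ 2 / 100 ≤ w ^ 2 := by nlinarith
    have h2 : 1 / 50 * w ^ 2 ≤ cos θ * cos t * w ^ 2 :=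
      mul_le_mul_of_nonneg_right c3 (sq_nonneg _)
    nlinarith [sq_nonneg (θ - t), sq_nonneg a]
  have A : ((θ - t) ^ 2 + a ^ 2) / 2000 ≤ ‖sc φ θ - sc a t‖ ^ 2 := by
    rw [normsq]; exact key _ s1
  have B : ((θ - t) ^ 2 + a ^ 2) / 2000 ≤ ‖sc φ θ - flip2 (sc a t)‖ ^ 2 := by
    rw [flip2_sc, normsq]
    have : sin ((-a - φ) / 2) = - sin ((a + φ) / 2) := by rw [← sin_neg]; ring_nf
    rw [this, neg_sq]; exact key _ s2
  have hS : 0 < (θ - t) ^ 2 + a ^ 2 := by positivity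
  have e1 : (sc a t) 1 = cos t * sin a := by simp [sc, vec3]
  have e2 : (sc a t) 2 = sin t := by simp [sc, vec3]
  have e3 : (sc φ θ) 2 = sin θ := by simp [sc, vec3]
  rw [e1, e2, e3]
  have sa : 0 ≤ sin a := sin_nonneg_of_nonneg_of_le_pi ha0.le haπ.le
  have n1 : cos t * sin a ≤ a := by
    have := sin_le ha0.le
    nlinarith [cos_le_one t]
  have n2 : |sin θ - sin t| ≤ |θ - t| := by
    have := (Real.lipschitzWith_sin).dist_le_mul θ t
    simpa [Real.dist_eq] using this
  have n0 : 0 ≤ cos t * sin a := by nlinarith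
  rw [Real.norm_of_nonneg (by positivity)]
  calc _ ≤ 2 * a * |θ - t| / (((θ - t) ^ 2 + a ^ 2) / 2000 * (((θ - t) ^ 2 + a ^ 2) / 2000)) := by
        gcongr
    _ = _ := by field_simp; ring

lemma meas_bd (D : Set (ℝ × ℝ)) :
    sigma2.restrict ((fun p : ℝ × ℝ => sc p.1 p.2) '' D) ≤
      (4 : ℝ≥0∞) • Measure.map (fun p : ℝ × ℝ => sc p.1 p.2) (volume.restrict D) := by
  have hm : Measurable (fun p : ℝ × ℝ => sc p.1 p.2) := sc_lip.continuous.measurable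
  rw [Measure.le_iff]
  intro A hA
  rw [Measure.restrict_apply hA, Measure.smul_apply, Measure.map_apply hm hA,
    Measure.restrict_apply (hm hA)]
  refine (Measure.restrict_apply_le _ _).trans ?_
  have : A ∩ (fun p : ℝ × ℝ => sc p.1 p.2) '' D =
    (fun p : ℝ × ℝ => sc p.1 p.2) '' ((fun p : ℝ × ℝ => sc p.1 p.2) ⁻¹' A ∩ D) := by
    rw [image_preimage_inter]
  rw [this]
  refine (sc_lip.hausdorffMeasure_image_le (d := 2) (by norm_num) _).trans ?_
  rw [hausdorffMeasure_prod_real]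
  apply le_of_eq
  rw [smul_eq_mul]
  congr 1
  norm_num

/-- Logarithmic kernel bound on the strip `Q₃`. -/
theorem log_kernel_bound_strip :
    ∃ C : ℝ, 0 < C ∧
      ∀ φ ∈ Ioc (0:ℝ) 1, ∀ θ ∈ Ioc (0:ℝ) 1,
        (∫ y in (fun p : ℝ × ℝ => sc p.1 p.2) ''
              (Ico (3 * φ / 2) Real.pi ×ˢ Ioc (0:ℝ) (3 * θ / 2)),
            2 * y 1 * |(sc φ θ) 2 - y 2| / (‖sc φ θ - y‖ ^ 2 * ‖sc φ θ - flip2 y‖ ^ 2)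
            ∂sigma2) ≤
          C * (log (1 + θ / φ) + 1) := by

  refine ⟨32000000, by norm_num, ?_⟩
  intro φ hφ θ hθ
  have hL : 0 ≤ log (1 + θ / φ) := log_nonneg (by
    have := div_pos hθ.1 hφ.1
    linarith)
  have hD : MeasurableSet (Ico (3 * φ / 2) π ×ˢ Ioc (0:ℝ) (3 * θ / 2)) :=
    measurableSet_Ico.prod measurableSet_Ioc
  refine (le_abs_self _).trans ?_
  rw [← Real.norm_eq_abs]
  refine (norm_integral_le_lintegral_norm _).trans ?_
  apply ENNReal.toReal_le_of_le_ofReal (by positivity)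
  refine (lintegral_mono' (meas_bd _) le_rfl).trans ?_
  rw [lintegral_smul_measure]
  have h1 := lintegral_map_le (μ := volume.restrict (Ico (3 * φ / 2) π ×ˢ Ioc (0:ℝ) (3 * θ / 2)))
    (fun y : E3 => ENNReal.ofReal ‖2 * y 1 * |(sc φ θ) 2 - y 2| /
      (‖sc φ θ - y‖ ^ 2 * ‖sc φ θ - flip2 y‖ ^ 2)‖) (fun p : ℝ × ℝ => sc p.1 p.2)
  have h2 : ∫⁻ p in Ico (3 * φ / 2) π ×ˢ Ioc (0:ℝ) (3 * θ / 2),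
      ENNReal.ofReal ‖2 * (sc p.1 p.2) 1 * |(sc φ θ) 2 - (sc p.1 p.2) 2| /
      (‖sc φ θ - (sc p.1 p.2)‖ ^ 2 * ‖sc φ θ - flip2 (sc p.1 p.2)‖ ^ 2)‖ ≤
      ENNReal.ofReal 8000000 * ENNReal.ofReal (log (1 + θ / φ)) := by
    refine le_trans ?_ (mul_le_mul_right (double_bd φ θ hφ.1 hφ.2 hθ.1) _)
    rw [← lintegral_const_mul _ (by fun_prop)]
    apply setLIntegral_mono' hD
    rintro ⟨a, t⟩ ⟨h, h'⟩
    rw [← ENNReal.ofReal_mul (by norm_num)]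
    exact ENNReal.ofReal_le_ofReal (pointwise φ θ a t hφ.1 hφ.2 hθ.1 hθ.2 h.1 h.2 h'.1 h'.2)
  rw [smul_eq_mul]
  refine (mul_le_mul_right (h1.trans h2) _).trans ?_
  have h4 : (4 : ℝ≥0∞) = ENNReal.ofReal 4 := by norm_num
  rw [h4, ← ENNReal.ofReal_mul (by norm_num), ← ENNReal.ofReal_mul (by norm_num)]
  apply ENNReal.ofReal_le_ofReal
  linarith
end
end

section
/- (Quarter-sphere reduction of the φ-velocity under odd-odd symmetry, identity (2.1).) Let ω : S² → ℝ be bounded measurable and odd-odd symmetric, and let u be its Biot–Savart velocity. Then for every x ∈ S² with x₃ ≠ ±1, u(x)·e_φ(x) = ( x₂ / (π√(1−x₃²)) ) ∫_{S²_q} [ 2y₂(x₃−y₃) / ( |x−y|² |x−ỹ|² ) − 2y₂(x₃+y₃) / ( |x−ȳ|² |x−\bar{ỹ}|² ) ] ω(y) dσ(y), where ȳ := (y₁,y₂,−y₃), ỹ := (y₁,−y₂,y₃) and \bar{ỹ} := (y₁,−y₂,−y₃). -/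
open MeasureTheory Real Filter Set
open scoped ENNReal NNReal

noncomputable section

theorem nsq (y : E3) : ‖y‖ ^ 2 = y 0 ^ 2 + y 1 ^ 2 + y 2 ^ 2 := by
  rw [EuclideanSpace.norm_sq_eq, Fin.sum_univ_three]; simp

theorem mem_S2 (y : E3) : y ∈ S2 ↔ y 0 ^ 2 + y 1 ^ 2 + y 2 ^ 2 = 1 := by
  rw [← nsq, S2, mem_sphere_zero_iff_norm]
  constructor
  · intro h; rw [h]; norm_num
  · intro h; nlinarith [norm_nonneg y]

@[simp] theorem vec3_0 (a b c : ℝ) : vec3 a b c 0 = a := rfl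
@[simp] theorem vec3_1 (a b c : ℝ) : vec3 a b c 1 = b := rfl
@[simp] theorem vec3_2 (a b c : ℝ) : vec3 a b c 2 = c := rfl

theorem haus_le {p : E3 → ℝ × ℝ} {A : Set E3}
    (h : ∀ y ∈ A, ∀ z ∈ A, dist y z ≤ 6 * dist (p y) (p z)) :
    (μH[2] : Measure E3) A ≤ 36 * volume (p '' A) := by
  have ha : AntilipschitzWith 6 (fun y : A => p y) :=
    AntilipschitzWith.of_le_mul_dist fun y z => h y y.2 z z.2
  have h1 := ha.le_hausdorffMeasure_image (d := 2) (by norm_num) univ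
  have h2 := (isometry_subtype_coe (s := A)).hausdorffMeasure_image (d := 2) (Or.inl (by norm_num)) univ
  rw [image_univ, Subtype.range_coe] at h2
  rw [h2]
  refine h1.trans (le_of_eq ?_)
  rw [hausdorffMeasure_prod_real]
  congr 1
  · rw [ENNReal.rpow_ofNat]; norm_num
  · congr 1; ext z; simp

theorem piece_le (i j k : Fin 3) (hn : ∀ y : E3, ‖y‖ ^ 2 = y i ^ 2 + y j ^ 2 + y k ^ 2)
    (s : ℝ) (hs : s ^ 2 = 1) (x : E3) (r : ℝ) (hr : 0 ≤ r) :
    (μH[2] : Measure E3) {y | y ∈ S2 ∧ 1 / 2 ≤ s * y i ∧ ‖x - y‖ ≤ r} ≤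
      36 * ENNReal.ofReal (4 * r ^ 2) := by
  have hcoord : ∀ y : E3, |y i| ≤ ‖y‖ ∧ |y j| ≤ ‖y‖ ∧ |y k| ≤ ‖y‖ := by
    intro y
    refine ⟨?_, ?_, ?_⟩ <;>
    · refine abs_le_of_sq_le_sq ?_ (norm_nonneg y)
      rw [hn]
      nlinarith [sq_nonneg (y i), sq_nonneg (y j), sq_nonneg (y k)]
  have hS : ∀ y ∈ S2, ‖y‖ = 1 := fun y hy => by simpa [S2] using hy
  refine (haus_le (p := fun y => (y j, y k)) ?_).trans ?_
  · rintro y ⟨hy, hyi, -⟩ z ⟨hz, hzi, -⟩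
    have ny := hS y hy
    have nz := hS z hz
    have ey := hn y
    have ez := hn z
    rw [ny] at ey
    rw [nz] at ez
    obtain ⟨-, cy1, cy2⟩ := hcoord y
    obtain ⟨-, cz1, cz2⟩ := hcoord z
    rw [ny] at cy1 cy2
    rw [nz] at cz1 cz2
    set δ := dist (y j, y k) (z j, z k) with hδ
    have hd1 : |y j - z j| ≤ δ := by
      rw [hδ, Prod.dist_eq]; exact (Real.dist_eq _ _).symm.le.trans (le_max_left _ _)
    have hd2 : |y k - z k| ≤ δ := by
      rw [hδ, Prod.dist_eq]; exact (Real.dist_eq _ _).symm.le.trans (le_max_right _ _)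
    have hδ0 : 0 ≤ δ := dist_nonneg
    have key : |y i - z i| ≤ 4 * δ := by
      have e : (y i - z i) * (y i + z i) =
          -((y j - z j) * (y j + z j)) - (y k - z k) * (y k + z k) := by nlinarith
      have a1 : |y i + z i| ≥ 1 := by
        have : |s| = 1 := by
          rw [← sq_abs] at hs; nlinarith [abs_nonneg s]
        have h2 : |s * (y i + z i)| = |y i + z i| := by rw [abs_mul, this, one_mul]
        rw [← h2]
        refine le_trans ?_ (le_abs_self _)
        linarith
      have a2 : |(y i - z i) * (y i + z i)| ≤ δ * 2 + δ * 2 := by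
        rw [e]
        refine (abs_sub _ _).trans ?_
        rw [abs_neg, abs_mul, abs_mul]
        have b1 : |y j + z j| ≤ 2 := (abs_add_le _ _).trans (by linarith)
        have b2 : |y k + z k| ≤ 2 := (abs_add_le _ _).trans (by linarith)
        gcongr
      rw [abs_mul] at a2
      nlinarith [abs_nonneg (y i - z i)]
    rw [dist_eq_norm]
    have e := hn (y - z)
    simp only [PiLp.sub_apply] at e
    have q1 := sq_le_sq' (by linarith [(abs_le.1 key).1]) (abs_le.1 key).2
    have q2 := sq_le_sq' (by linarith [(abs_le.1 hd1).1]) (abs_le.1 hd1).2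
    have q3 := sq_le_sq' (by linarith [(abs_le.1 hd2).1]) (abs_le.1 hd2).2
    refine le_of_sq_le_sq ?_ (by positivity)
    rw [e]; nlinarith
  · gcongr
    have : (fun y : E3 => (y j, y k)) '' {y | y ∈ S2 ∧ 1 / 2 ≤ s * y i ∧ ‖x - y‖ ≤ r} ⊆
        Icc (x j - r) (x j + r) ×ˢ Icc (x k - r) (x k + r) := by
      rintro _ ⟨y, ⟨-, -, h⟩, rfl⟩
      obtain ⟨-, h1, h2⟩ := hcoord (x - y)
      have h1 := abs_le.1 (h1.trans h)
      have h2 := abs_le.1 (h2.trans h)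
      simp only [PiLp.sub_apply] at h1 h2
      simp only [mem_prod, mem_Icc]
      refine ⟨⟨?_, ?_⟩, ?_, ?_⟩ <;> linarith
    refine (measure_mono this).trans (le_of_eq ?_)
    rw [Measure.volume_eq_prod, Measure.prod_prod, Real.volume_Icc, Real.volume_Icc,
      ← ENNReal.ofReal_mul (by linarith)]
    congr 1; ring

theorem sigma_ball (x : E3) (r : ℝ) (hr : 0 ≤ r) :
    sigma2 {y | ‖x - y‖ ≤ r} ≤ ENNReal.ofReal (864 * r ^ 2) := by
  have hm : MeasurableSet {y : E3 | ‖x - y‖ ≤ r} :=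
    measurableSet_le (by fun_prop) (by fun_prop)
  rw [sigma2, Measure.restrict_apply hm]
  let P : Fin 3 → ℝ → Set E3 := fun i s => {y | y ∈ S2 ∧ 1 / 2 ≤ s * y i ∧ ‖x - y‖ ≤ r}
  have hsub : {y : E3 | ‖x - y‖ ≤ r} ∩ S2 ⊆
      ((P 0 1 ∪ P 0 (-1)) ∪ (P 1 1 ∪ P 1 (-1))) ∪ (P 2 1 ∪ P 2 (-1)) := by
    rintro y ⟨hy, hS⟩
    have hy : ‖x - y‖ ≤ r := hy
    have h := (mem_S2 y).1 hS
    by_contra hc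
    simp only [P, mem_union, mem_ofPred_eq, hS, hy, true_and, and_true, not_or, not_le, one_mul,
      neg_mul] at hc
    obtain ⟨⟨⟨a, b⟩, c, d⟩, e, f⟩ := hc
    nlinarith
  have hP : ∀ i : Fin 3, ∀ s : ℝ, s ^ 2 = 1 →
      (μH[2] : Measure E3) (P i s) ≤ 36 * ENNReal.ofReal (4 * r ^ 2) := by
    intro i s hs
    fin_cases i
    · exact piece_le 0 1 2 (fun y => nsq y) s hs x r hr
    · exact piece_le 1 0 2 (fun y => by rw [nsq]; ring) s hs x r hr
    · exact piece_le 2 0 1 (fun y => by rw [nsq]; ring) s hs x r hr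
  have h1 := fun i => hP i 1 (by norm_num)
  have h2 := fun i => hP i (-1) (by norm_num)
  refine (measure_mono hsub).trans ?_
  have hu : ∀ i, (μH[2] : Measure E3) (P i 1 ∪ P i (-1)) ≤
      36 * ENNReal.ofReal (4 * r ^ 2) + 36 * ENNReal.ofReal (4 * r ^ 2) := fun i =>
    (measure_union_le _ _).trans (add_le_add (h1 i) (h2 i))
  refine (measure_union_le _ _).trans ((add_le_add ((measure_union_le _ _).trans
    (add_le_add (hu 0) (hu 1))) (hu 2)).trans (le_of_eq ?_))
  have : (36 : ℝ≥0∞) = ENNReal.ofReal 36 := by simp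
  rw [this, ← ENNReal.ofReal_mul (by norm_num), ← ENNReal.ofReal_add (by positivity) (by positivity),
    ← ENNReal.ofReal_add (by positivity) (by positivity),
    ← ENNReal.ofReal_add (by positivity) (by positivity)]
  congr 1; ring

theorem sigma_fin : sigma2 univ ≤ ENNReal.ofReal 864 := by
  have h := sigma_ball 0 1 (by norm_num)
  have h2 : sigma2 univ ≤ sigma2 {y : E3 | ‖(0 : E3) - y‖ ≤ 1} := by
    have hm : MeasurableSet {y : E3 | ‖(0 : E3) - y‖ ≤ 1} :=
      measurableSet_le (by fun_prop) (by fun_prop)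
    rw [sigma2, Measure.restrict_apply hm, Measure.restrict_apply MeasurableSet.univ]
    refine measure_mono ?_
    rintro y ⟨-, hy⟩
    refine ⟨?_, hy⟩
    have : ‖y‖ = 1 := by simpa [S2] using hy
    simp [this]
  simpa using h2.trans h

theorem int_inv (x : E3) : Integrable (fun y => ‖x - y‖⁻¹) sigma2 := by
  have hm : Measurable (fun y : E3 => ‖x - y‖⁻¹) := by fun_prop
  refine ⟨hm.aestronglyMeasurable, ?_⟩
  rw [hasFiniteIntegral_iff_ofReal (Eventually.of_forall fun y => by positivity),
    lintegral_eq_lintegral_meas_lt _ (Eventually.of_forall fun y => by positivity) hm.aemeasurable,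
    ← Ioc_union_Ioi_eq_Ioi (zero_le_one' ℝ)]
  refine (lintegral_union_le _ _ _).trans_lt (ENNReal.add_lt_top.2 ⟨?_, ?_⟩)
  · refine (lintegral_mono (g := fun _ => ENNReal.ofReal 864)
      fun t => (measure_mono (subset_univ _)).trans sigma_fin).trans_lt ?_
    simp
  · have hi : IntegrableOn (fun t : ℝ => 864 * t ^ (-2 : ℝ)) (Ioi 1) :=
      (integrableOn_Ioi_rpow_of_lt (by norm_num) one_pos).const_mul _
    refine lt_of_le_of_lt (setLIntegral_mono' measurableSet_Ioi ?_) hi.lintegral_lt_top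
    intro t ht
    have ht : (0 : ℝ) < t := lt_trans one_pos ht
    have h := sigma_ball x t⁻¹ (by positivity)
    refine (measure_mono ?_).trans (h.trans (le_of_eq ?_))
    · intro y hy
      have hy : t < ‖x - y‖⁻¹ := hy
      exact ((lt_inv_comm₀ ht (inv_pos.1 (ht.trans hy))).1 hy).le
    · rw [Real.rpow_neg ht.le, Real.rpow_ofNat, inv_pow]

theorem flip2_invol (y : E3) : flip2 (flip2 y) = y := by
  ext i; fin_cases i <;> simp [flip2]
theorem flip3_invol (y : E3) : flip3 (flip3 y) = y := by
  ext i; fin_cases i <;> simp [flip3]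

theorem flip_mp (F : E3 → E3) (hinv : ∀ y, F (F y) = y) (hn : ∀ y z, ‖F y - F z‖ ^ 2 = ‖y - z‖ ^ 2)
    (hS : ∀ y, F y ∈ S2 ↔ y ∈ S2) : MeasurePreserving F sigma2 sigma2 ∧ MeasurableEmbedding F := by
  have hiso : Isometry F := Isometry.of_dist_eq fun y z => by
    rw [dist_eq_norm, dist_eq_norm]
    exact (sq_eq_sq₀ (norm_nonneg _) (norm_nonneg _)).1 (hn y z)
  let e : E3 ≃ᵢ E3 := ⟨⟨F, F, hinv, hinv⟩, hiso⟩
  have h := e.measurePreserving_hausdorffMeasure 2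
  refine ⟨?_, e.toHomeomorph.measurableEmbedding⟩
  have h2 := h.restrict_preimage (s := S2) (Metric.isClosed_sphere.measurableSet)
  have h3 : e ⁻¹' S2 = S2 := by ext y; exact hS y
  rw [h3] at h2
  exact h2

theorem flip2_mp : MeasurePreserving flip2 sigma2 sigma2 ∧ MeasurableEmbedding flip2 := by
  refine flip_mp _ flip2_invol (fun y z => ?_) (fun y => ?_)
  · rw [nsq, nsq]; simp [flip2]; ring
  · rw [mem_S2, mem_S2]; simp [flip2]

theorem flip3_mp : MeasurePreserving flip3 sigma2 sigma2 ∧ MeasurableEmbedding flip3 := by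
  refine flip_mp _ flip3_invol (fun y z => ?_) (fun y => ?_)
  · rw [nsq, nsq]; simp [flip3]; ring
  · rw [mem_S2, mem_S2]; simp [flip3]

theorem fold (μ : Measure E3) (F : E3 → E3) (hF : MeasurePreserving F μ μ)
    (hE : MeasurableEmbedding F) (c : E3 → ℝ) (hc : Measurable c) (hcF : ∀ y, c (F y) = - c y)
    (g : E3 → ℝ) (hg : Integrable g μ) (h0 : ∀ᵐ y ∂μ, c y = 0 → g y = 0) :
    ∫ y, g y ∂μ = ∫ y in {y | 0 < c y}, (g y + g (F y)) ∂μ := by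
  have hs : MeasurableSet {y | 0 < c y} := measurableSet_lt measurable_const hc
  have ht : MeasurableSet {y | c y < 0} := measurableSet_lt hc measurable_const
  have h1 : ∫ y, g y ∂μ = ∫ y in {y | 0 < c y} ∪ {y | c y < 0}, g y ∂μ := by
    rw [← integral_indicator (hs.union ht)]
    refine integral_congr_ae ?_
    filter_upwards [h0] with y hy
    by_cases h : y ∈ {y | 0 < c y} ∪ {y | c y < 0}
    · rw [indicator_of_mem h]
    · rw [indicator_of_notMem h]
      simp only [mem_union, mem_ofPred_eq, not_or, not_lt] at h
      exact hy (le_antisymm h.1 h.2)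
  have h2 : ∫ y in {y | 0 < c y}, g (F y) ∂μ = ∫ y in {y | c y < 0}, g y ∂μ := by
    have h3 := hF.setIntegral_preimage_emb hE g {y | c y < 0}
    have h4 : F ⁻¹' {y | c y < 0} = {y | 0 < c y} := by ext y; simp [hcF]
    rw [← h3, h4]
  have hgF : Integrable (fun y => g (F y)) μ := hF.integrable_comp_of_integrable hg
  rw [h1, setIntegral_union ?_ ht hg.integrableOn hg.integrableOn,
    integral_add hg.integrableOn hgF.integrableOn, h2]
  rw [Set.disjoint_left]
  intro y hy hy'
  have h1 : 0 < c y := hy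
  have h2 : c y < 0 := hy'
  linarith

theorem dist_aux (x y : E3) (hx : x ∈ S2) (hy : y ∈ S2) :
    ‖x - y‖ ^ 2 = 2 - 2 * (x 0 * y 0 + x 1 * y 1 + x 2 * y 2) := by
  rw [mem_S2] at hx hy
  rw [nsq]; simp only [PiLp.sub_apply]; nlinarith

theorem vec_int (ω : E3 → ℝ) (M : ℝ) (hmeas : Measurable ω)
    (hbdd : ∀ y, |ω y| ≤ M) (x : E3) (hx : x ∈ S2) :
    Integrable (fun y => (‖x - y‖ ^ 2)⁻¹ • ω y • cross3 x y) sigma2 := by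
  have hc : Measurable (fun y => cross3 x y) := by
    have : Continuous (fun y => cross3 x y) := by
      unfold cross3 vec3
      refine (PiLp.continuous_toLp 2 _).comp (continuous_pi fun i => ?_)
      fin_cases i <;> simp <;> fun_prop
    exact this.measurable
  have hM : Measurable (fun y => (‖x - y‖ ^ 2)⁻¹ • ω y • cross3 x y) := by
    have h1 : Measurable (fun y : E3 => (‖x - y‖ ^ 2)⁻¹) := by fun_prop
    exact h1.smul (hmeas.smul hc)
  refine ((int_inv x).const_mul M).mono' hM.aestronglyMeasurable ?_
  rw [sigma2]
  filter_upwards [ae_restrict_mem (Metric.isClosed_sphere.measurableSet)] with y hy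
  have hcr : ‖cross3 x y‖ ≤ ‖x - y‖ := by
    refine le_of_sq_le_sq ?_ (norm_nonneg _)
    have hd := dist_aux x y hx hy
    rw [hd, nsq]
    have h1 := (mem_S2 x).1 hx
    have h2 := (mem_S2 y).1 hy
    simp only [cross3, vec3_0, vec3_1, vec3_2]
    have : (x 1 * y 2 - x 2 * y 1) ^ 2 + (x 2 * y 0 - x 0 * y 2) ^ 2 + (x 0 * y 1 - x 1 * y 0) ^ 2
        = (x 0 ^ 2 + x 1 ^ 2 + x 2 ^ 2) * (y 0 ^ 2 + y 1 ^ 2 + y 2 ^ 2)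
          - (x 0 * y 0 + x 1 * y 1 + x 2 * y 2) ^ 2 := by ring
    rw [this, h1, h2]
    nlinarith [sq_nonneg (x 0 * y 0 + x 1 * y 1 + x 2 * y 2 - 1)]
  rw [norm_smul, norm_smul, norm_inv, norm_pow, norm_norm, Real.norm_eq_abs]
  have hM0 : 0 ≤ M := (abs_nonneg _).trans (hbdd y)
  calc (‖x - y‖ ^ 2)⁻¹ * (|ω y| * ‖cross3 x y‖)
      ≤ (‖x - y‖ ^ 2)⁻¹ * (M * ‖x - y‖) := by gcongr; exact hbdd y
    _ = M * ‖x - y‖⁻¹ := by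
      by_cases h : ‖x - y‖ = 0
      · simp [h]
      · field_simp

theorem alg_aux (x y : E3) (w : ℝ) (hx : x ∈ S2) (hy : y ∈ S2) (hne : ‖x - y‖ ^ 2 ≠ 0) :
    (‖x - y‖ ^ 2)⁻¹ * (w * dot3 (cross3 x y) (ephi x)) =
      w / sqrt (1 - (x 2) ^ 2) * ((x 2 - y 2) / ‖x - y‖ ^ 2 - x 2 / 2) := by
  have hd := dist_aux x y hx hy
  have h1 := (mem_S2 x).1 hx
  have hN : dot3 (cross3 x y) (ephi x) =
      (x 2 - y 2 - x 2 * ‖x - y‖ ^ 2 / 2) / sqrt (1 - (x 2) ^ 2) := by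
    rw [hd]
    have : x 0 ^ 2 = 1 - x 1 ^ 2 - x 2 ^ 2 := by linarith
    simp only [dot3, cross3, ephi, vec3_0, vec3_1, vec3_2]
    rw [mul_zero, add_zero, mul_div_assoc', mul_div_assoc', ← add_div]
    congr 1
    linear_combination (-y 2) * h1
  rw [hN]
  clear hd hN
  generalize ‖x - y‖ ^ 2 = a at *
  have : w / √(1 - x 2 ^ 2) * ((x 2 - y 2) / a - x 2 / 2) =
      w / √(1 - x 2 ^ 2) * (a⁻¹ * (x 2 - y 2 - x 2 * a / 2)) := by
    congr 1; field_simp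
  rw [this]; ring

/-- Quarter-sphere reduction of the `φ`-velocity under odd-odd
symmetry, identity (2.1). -/
theorem quarter_sphere_reduction_phi (ω : E3 → ℝ) (M : ℝ) (hmeas : Measurable ω)
    (hbdd : ∀ y, |ω y| ≤ M) (hsym : OddOdd ω) :
    ∀ x ∈ S2, x 2 ≠ 1 → x 2 ≠ -1 →
      dot3 (biotSavart ω x) (ephi x) =
        (x 1 / (Real.pi * sqrt (1 - (x 2) ^ 2))) *
          ∫ y in S2q,
            (2 * y 1 * (x 2 - y 2) / (‖x - y‖ ^ 2 * ‖x - flip2 y‖ ^ 2) -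
              2 * y 1 * (x 2 + y 2) / (‖x - flip3 y‖ ^ 2 * ‖x - flip2 (flip3 y)‖ ^ 2)) *
            ω y ∂sigma2 := by
  intro x hx _ _
  have hdot : ∀ v e : E3, dot3 v e = inner ℝ e v := by
    intro v e
    rw [PiLp.inner_apply, Fin.sum_univ_three]; simp [dot3]
  have hI := vec_int ω M hmeas hbdd x hx
  let g : E3 → ℝ := fun y => (‖x - y‖ ^ 2)⁻¹ * (ω y * dot3 (cross3 x y) (ephi x))
  have hgeq : ∀ y, inner ℝ (ephi x) ((‖x - y‖ ^ 2)⁻¹ • ω y • cross3 x y) = g y := by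
    intro y
    rw [inner_smul_right, inner_smul_right, ← hdot]
  have hg : Integrable g sigma2 := by
    have := hI.const_inner (𝕜 := ℝ) (ephi x)
    simpa only [hgeq] using this
  have hL : dot3 (biotSavart ω x) (ephi x) = (2 * Real.pi)⁻¹ * ∫ y, g y ∂sigma2 := by
    rw [hdot, biotSavart, inner_smul_right, ← integral_inner hI]
    simp only [hgeq]
  have hmS : MeasurableSet S2 := Metric.isClosed_sphere.measurableSet
  have hae : ∀ᵐ y ∂sigma2, y ∈ S2 := ae_restrict_mem hmS
  have hf2S : ∀ y ∈ S2, flip2 y ∈ S2 := fun y hy => by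
    rw [mem_S2] at hy ⊢; simpa [flip2] using hy
  have hf3S : ∀ y ∈ S2, flip3 y ∈ S2 := fun y hy => by
    rw [mem_S2] at hy ⊢; simpa [flip3] using hy
  have hw2 : ∀ y ∈ S2, y 1 = 0 → ω y = 0 := fun y hy h => by
    have : flip2 y = y := by ext i; fin_cases i <;> simp [flip2, h]
    have h2 := (hsym y hy).1
    rw [this] at h2; linarith
  have hw3 : ∀ y ∈ S2, y 2 = 0 → ω y = 0 := fun y hy h => by
    have : flip3 y = y := by ext i; fin_cases i <;> simp [flip3, h]
    have h2 := (hsym y hy).2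
    rw [this] at h2; linarith
  have hA := fold sigma2 flip2 flip2_mp.1 flip2_mp.2 (fun y => y 1) (by fun_prop)
    (fun y => by simp [flip2]) g hg (by
      filter_upwards [hae] with y hy h
      simp only [g, hw2 y hy h, zero_mul, mul_zero])
  have hm1 : MeasurableSet {y : E3 | 0 < y 1} := measurableSet_lt (by fun_prop) (by fun_prop)
  have hm2 : MeasurableSet {y : E3 | 0 < y 2} := measurableSet_lt (by fun_prop) (by fun_prop)
  have hmp3 : MeasurePreserving flip3 (sigma2.restrict {y | 0 < y 1})
      (sigma2.restrict {y | 0 < y 1}) := by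
    have := flip3_mp.1.restrict_preimage (s := {y | 0 < y 1}) hm1
    have e : flip3 ⁻¹' {y | 0 < y 1} = {y | 0 < y 1} := by ext y; simp [flip3]
    rwa [e] at this
  have hB := fold (sigma2.restrict {y | 0 < y 1}) flip3 hmp3 flip3_mp.2 (fun y => y 2) (by fun_prop)
    (fun y => by simp [flip3]) (fun y => g y + g (flip2 y))
    (hg.add (flip2_mp.1.integrable_comp_of_integrable hg)).integrableOn (by
      filter_upwards [ae_restrict_of_ae hae] with y hy h
      have h2 : ω (flip2 y) = 0 := by rw [(hsym y hy).1, hw3 y hy h, neg_zero]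
      simp only [g, hw3 y hy h, h2, zero_mul, mul_zero, add_zero])
  have hset : (sigma2.restrict {y : E3 | 0 < y 1}).restrict {y | 0 < y 2} = sigma2.restrict S2q := by
    rw [Measure.restrict_restrict hm2]
    refine Measure.restrict_congr_set ?_
    filter_upwards [hae] with y hy
    refine propext ⟨fun h => ⟨hy, h.2, h.1⟩, fun h => ⟨h.2.2, h.2.1⟩⟩
  rw [hL, hA, hB, hset, ← integral_const_mul, ← integral_const_mul]
  have : NullSingletonClass (μH[2] : Measure E3) := Measure.nullSingletonClass_hausdorff E3 two_pos
  have hne : ∀ z : E3, ∀ᵐ y ∂(sigma2.restrict S2q), y ≠ z := by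
    intro z
    refine ae_restrict_of_ae (ae_restrict_of_ae ?_)
    rw [ae_iff]; simp
  refine integral_congr_ae ?_
  filter_upwards [ae_restrict_of_ae hae, hne x, hne (flip2 x), hne (flip3 x),
    hne (flip3 (flip2 x))] with y hy n1 n2 n3 n4
  have hpos : ∀ z : E3, x ≠ z → ‖x - z‖ ^ 2 ≠ 0 := fun z h =>
    pow_ne_zero 2 (norm_ne_zero_iff.2 (sub_ne_zero.2 h))
  have p1 := hpos y n1.symm
  have p2 := hpos (flip2 y) (fun h => n2 (by rw [h, flip2_invol]))
  have p3 := hpos (flip3 y) (fun h => n3 (by rw [h, flip3_invol]))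
  have p4 := hpos (flip2 (flip3 y)) (fun h => n4 (by rw [h, flip2_invol, flip3_invol]))
  have w2 := (hsym y hy).1
  have w3 := (hsym y hy).2
  have w4 : ω (flip2 (flip3 y)) = ω y := by
    rw [(hsym _ (hf3S y hy)).1, w3, neg_neg]
  have d1 := dist_aux x y hx hy
  have d2 := dist_aux x _ hx (hf2S y hy)
  have d3 := dist_aux x _ hx (hf3S y hy)
  have d4 := dist_aux x _ hx (hf2S _ (hf3S y hy))
  simp only [g]
  rw [alg_aux x y _ hx hy p1, alg_aux x _ _ hx (hf2S y hy) p2, alg_aux x _ _ hx (hf3S y hy) p3,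
    alg_aux x _ _ hx (hf2S _ (hf3S y hy)) p4, w2, w3, w4]
  have e2 : flip2 y 2 = y 2 := rfl
  have e3 : flip3 y 2 = - y 2 := rfl
  have e4 : flip2 (flip3 y) 2 = - y 2 := rfl
  rw [e2, e3, e4]
  have k1 : ‖x - flip2 y‖ ^ 2 - ‖x - y‖ ^ 2 = 4 * x 1 * y 1 := by
    rw [d1, d2]; simp only [flip2, vec3_0, vec3_1, vec3_2]; ring
  have k2 : ‖x - flip2 (flip3 y)‖ ^ 2 - ‖x - flip3 y‖ ^ 2 = 4 * x 1 * y 1 := by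
    rw [d3, d4]; simp only [flip2, flip3, vec3_0, vec3_1, vec3_2]; ring
  clear d1 d2 d3 d4
  generalize ‖x - y‖ ^ 2 = a at *
  generalize ‖x - flip2 y‖ ^ 2 = b at *
  generalize ‖x - flip3 y‖ ^ 2 = c at *
  generalize ‖x - flip2 (flip3 y)‖ ^ 2 = d at *
  have hπ := Real.pi_ne_zero
  have q1 : (x 2 - y 2) / a - (x 2 - y 2) / b = 2 * x 1 * (2 * y 1 * (x 2 - y 2) / (a * b)) := by
    field_simp
    linear_combination (x 2 - y 2) * k1
  have q2 : (x 2 + y 2) / c - (x 2 + y 2) / d = 2 * x 1 * (2 * y 1 * (x 2 + y 2) / (c * d)) := by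
    field_simp
    linear_combination (x 2 + y 2) * k2
  have q3 : x 1 / (π * √(1 - x 2 ^ 2)) = (2 * π)⁻¹ * (2 * x 1) * (√(1 - x 2 ^ 2))⁻¹ := by
    rw [div_eq_mul_inv, mul_inv, mul_inv]; ring
  rw [q3]
  rw [sub_neg_eq_add]
  linear_combination (2 * π)⁻¹ * (√(1 - x 2 ^ 2))⁻¹ * ω y * (q1 - q2)
end
end
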